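/- There is no semi-equivelar map of type {3^4, 6} on the Klein bottle; equivalently, i(n)_{3^4,6} = 0 for every n. -/

import Mathlib

/-!
A combinatorial (flag) model of polyhedral maps on surfaces.

A map on a compact surface is encoded by its set of flags (incident
vertex-edge-face triples) together with three involutions `s0`, `s1`, `s2`,
changing respectively the vertex, the edge and the face of a flag.
Vertices, edges and faces of the map are the orbits of the pairs
`{s1, s2}`, `{s0, s2}` and `{s0, s1}` respectively.  For a map on a closed
surface all three involutions are fixed-point free; fixed points of `s2`
correspond to boundary flags of a surface with boundary.  By the
classification of compact surfaces, the underlying surface is the Klein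
bottle if and only if the map is connected, closed, has Euler
characteristic `0` and is non-orientable; a compact connected surface with
non-empty boundary and Euler characteristic `0` is a cylinder (annulus) if
it is orientable and a Möbius strip otherwise.
-/

/-- The raw data of a combinatorial map: a finite set of flags together with
three permutations (intended to be the three flag involutions). -/
structure PreMap where
  flag : Type
  fintype : Fintype flag
  s0 : Equiv.Perm flag
  s1 : Equiv.Perm flag
  s2 : Equiv.Perm flag

attribute [instance] PreMap.fintype

namespace PreMap

variable (M : PreMap)

/-- Generating relation for "the two flags belong to the same vertex". -/
def vRel : M.flag → M.flag → Prop := fun f g => g = M.s1 f ∨ g = M.s2 f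

/-- Generating relation for "the two flags belong to the same edge". -/
def eRel : M.flag → M.flag → Prop := fun f g => g = M.s0 f ∨ g = M.s2 f

/-- Generating relation for "the two flags belong to the same face". -/
def fRel : M.flag → M.flag → Prop := fun f g => g = M.s0 f ∨ g = M.s1 f

/-- The vertices of a map: orbits of flags under `⟨s1, s2⟩`. -/
def VertexOf : Type := Quot M.vRel

/-- The edges of a map: orbits of flags under `⟨s0, s2⟩`. -/
def EdgeOf : Type := Quot M.eRel

/-- The faces of a map: orbits of flags under `⟨s0, s1⟩`. -/
def FaceOf : Type := Quot M.fRel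

/-- The vertex a flag belongs to. -/
def vertexOfFlag (f : M.flag) : M.VertexOf := Quot.mk _ f

/-- The edge a flag belongs to. -/
def edgeOfFlag (f : M.flag) : M.EdgeOf := Quot.mk _ f

/-- The face a flag belongs to. -/
def faceOfFlag (f : M.flag) : M.FaceOf := Quot.mk _ f

/-- Two flags are incident to the same vertex. -/
def SameVertex (f g : M.flag) : Prop := M.vertexOfFlag f = M.vertexOfFlag g

/-- Two flags are incident to the same edge. -/
def SameEdge (f g : M.flag) : Prop := M.edgeOfFlag f = M.edgeOfFlag g

/-- Two flags are incident to the same face. -/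
def SameFace (f g : M.flag) : Prop := M.faceOfFlag f = M.faceOfFlag g

/-- The number of vertices of a map. -/
noncomputable def nV : ℕ := Nat.card M.VertexOf

/-- The number of edges of a map. -/
noncomputable def nE : ℕ := Nat.card M.EdgeOf

/-- The number of faces of a map. -/
noncomputable def nF : ℕ := Nat.card M.FaceOf

/-- The Euler characteristic `V - E + F` of a map. -/
noncomputable def euler : ℤ := (M.nV : ℤ) - (M.nE : ℤ) + (M.nF : ℤ)

/-- A map is connected if any two flags are joined by a chain of the three
involutions. -/
def Connected : Prop :=
  ∀ f g : M.flag, Relation.EqvGen (fun a b => b = M.s0 a ∨ b = M.s1 a ∨ b = M.s2 a) f g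

/-- A map is orientable if its flags can be properly `2`-coloured, the
colour being switched by each involution (boundary flags, i.e. fixed points
of `s2`, excepted). -/
def Orientable : Prop :=
  ∃ c : M.flag → Bool, (∀ f, c (M.s0 f) ≠ c f) ∧ (∀ f, c (M.s1 f) ≠ c f) ∧
    (∀ f, M.s2 f ≠ f → c (M.s2 f) ≠ c f)

/-- The axioms of a combinatorial map on a closed surface: the three
permutations are fixed-point-free involutions, `s0` and `s2` commute and
their product is fixed-point free, and the map is connected and nonempty. -/
def IsClosedSurfaceMap : Prop :=
  Nonempty M.flag ∧
  (∀ f, M.s0 (M.s0 f) = f) ∧ (∀ f, M.s1 (M.s1 f) = f) ∧ (∀ f, M.s2 (M.s2 f) = f) ∧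
  (∀ f, M.s0 f ≠ f) ∧ (∀ f, M.s1 f ≠ f) ∧ (∀ f, M.s2 f ≠ f) ∧
  (∀ f, M.s0 (M.s2 f) = M.s2 (M.s0 f)) ∧ (∀ f, M.s0 (M.s2 f) ≠ f) ∧
  M.Connected

/-- The axioms of a combinatorial map on a compact surface with (possibly
empty) boundary: fixed points of `s2` are the boundary flags. -/
def IsMapWithBoundary : Prop :=
  Nonempty M.flag ∧
  (∀ f, M.s0 (M.s0 f) = f) ∧ (∀ f, M.s1 (M.s1 f) = f) ∧ (∀ f, M.s2 (M.s2 f) = f) ∧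
  (∀ f, M.s0 f ≠ f) ∧ (∀ f, M.s1 f ≠ f) ∧
  (∀ f, M.s0 (M.s2 f) = M.s2 (M.s0 f)) ∧
  M.Connected

/-- Polyhedrality: faces are embedded closed `2`-cells (each vertex and each
edge occurs at most once on the boundary of a face) and the link of every
vertex is a cycle.  Within one face, two flags at the same vertex are equal or
`s1`-related, two flags on the same edge are equal or `s0`-related; around one
vertex two flags on the same edge are equal or `s2`-related. -/
def IsPolyhedral : Prop :=
  (∀ f g, M.SameFace f g → M.SameVertex f g → g = f ∨ g = M.s1 f) ∧
  (∀ f g, M.SameFace f g → M.SameEdge f g → g = f ∨ g = M.s0 f) ∧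
  (∀ f g, M.SameVertex f g → M.SameEdge f g → g = f ∨ g = M.s2 f)

/-- A polyhedral map on the Klein bottle: a connected closed polyhedral map
with Euler characteristic `0` on a non-orientable surface. -/
def IsKleinBottleMap : Prop :=
  M.IsClosedSurfaceMap ∧ M.IsPolyhedral ∧ M.euler = 0 ∧ ¬ M.Orientable

/-- The number of sides of the face containing a flag (a `d`-gon carries
`2 * d` flags). -/
noncomputable def faceDeg (f : M.flag) : ℕ := Nat.card {g : M.flag // M.SameFace f g} / 2

/-- The degree of the vertex containing a flag (a vertex of degree `q`
carries `2 * q` flags). -/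
noncomputable def vertexDeg (f : M.flag) : ℕ := Nat.card {g : M.flag // M.SameVertex f g} / 2

/-- `M.HasVertexType L` says that `M` is semi-equivelar with face sequence
`L`: reading the sizes of the faces in cyclic order around any vertex
(by iterating the corner rotation `s1 * s2` from a suitable starting flag at
that vertex) yields exactly the list `L`. -/
def HasVertexType (L : List ℕ) : Prop :=
  ∀ f : M.flag, ∃ g : M.flag, M.SameVertex f g ∧ M.vertexDeg g = L.length ∧
    ∀ i : Fin L.length, M.faceDeg (((M.s1 * M.s2) ^ (i : ℕ)) g) = L.get i

end PreMap

/-- Isomorphism of maps: a bijection of flags commuting with the three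
involutions (this is the combinatorial counterpart of a homeomorphism of the
surface sending vertices to vertices, edges to edges and faces to faces and
preserving incidences). -/
def MapIso (M N : PreMap) : Prop :=
  ∃ e : M.flag ≃ N.flag,
    (∀ f, e (M.s0 f) = N.s0 (e f)) ∧ (∀ f, e (M.s1 f) = N.s1 (e f)) ∧
    (∀ f, e (M.s2 f) = N.s2 (e f))

/-- The semi-equivelar maps of vertex type `L` with `n` vertices on the Klein
bottle. -/
def SEKMap (L : List ℕ) (n : ℕ) : Type 1 :=
  {M : PreMap // M.IsKleinBottleMap ∧ M.HasVertexType L ∧ M.nV = n}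

/-- `iKlein L n`: the number of isomorphism classes of semi-equivelar maps of
vertex type `L` on the Klein bottle with `n` vertices. -/
noncomputable def iKlein (L : List ℕ) (n : ℕ) : ℕ :=
  Nat.card (Quot (fun M N : SEKMap L n => MapIso M.1 N.1))

/-! ### Submaps, cylinders and Möbius strips -/

open Classical in
/-- The involution `σ` adjusted to a set `S`: it agrees with `σ` on the pairs
`{x, σ x}` that do not cross the boundary of `S`, and fixes the crossing
elements.  This restricts to `S` and to its complement. -/
noncomputable def adjustInvol {α : Type} (σ : Equiv.Perm α) (S : Set α)
    (h : ∀ x, σ (σ x) = x) : Equiv.Perm α :=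
  Function.Involutive.toPerm (fun x => if x ∈ S ↔ σ x ∈ S then σ x else x)
    (by
      intro x
      by_cases hx : x ∈ S ↔ σ x ∈ S
      · have hσx : σ x ∈ S ↔ σ (σ x) ∈ S := by rw [h x]; exact hx.symm
        simp only [if_pos hx, h x, if_pos (Iff.symm hx)]
      · simp only [if_neg hx])

open Classical in
theorem adjustInvol_mem {α : Type} (σ : Equiv.Perm α) (S : Set α)
    (h : ∀ x, σ (σ x) = x) : ∀ x, x ∈ S ↔ adjustInvol σ S h x ∈ S := by
  intro x
  have hx' : adjustInvol σ S h x = if x ∈ S ↔ σ x ∈ S then σ x else x := rfl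
  rw [hx']
  by_cases hx : x ∈ S ↔ σ x ∈ S
  · simp only [if_pos hx]; exact hx
  · simp only [if_neg hx]

open Classical in
/-- Restriction of an involution `σ` to a subset `S`, fixing the flags whose
`σ`-image leaves `S` (these become boundary flags). -/
noncomputable def restrictInvol {α : Type} (σ : Equiv.Perm α) (S : Set α) :
    Equiv.Perm S :=
  if h : ∀ x, σ (σ x) = x then
    Equiv.Perm.subtypePerm (adjustInvol σ S h) (fun x => (adjustInvol_mem σ S h x).symm)
  else 1

namespace PreMap

/-- The submap of `M` carried by a set `S` of flags (intended: `S` a union of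
closed faces).  Flags whose `s2`-image leaves `S` become boundary flags. -/
noncomputable def subMap (M : PreMap) (S : Set M.flag) : PreMap where
  flag := S
  fintype := (Set.toFinite S).fintype
  s0 := restrictInvol M.s0 S
  s1 := restrictInvol M.s1 S
  s2 := restrictInvol M.s2 S

/-- A combinatorial cylinder (annulus): a compact connected orientable map
with non-empty boundary and Euler characteristic `0`. -/
def IsCylinder (N : PreMap) : Prop :=
  N.IsMapWithBoundary ∧ N.Orientable ∧ N.euler = 0 ∧ ∃ f, N.s2 f = f

/-- A combinatorial Möbius strip: a compact connected non-orientable map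
with non-empty boundary and Euler characteristic `0`. -/
def IsMobius (N : PreMap) : Prop :=
  N.IsMapWithBoundary ∧ ¬ N.Orientable ∧ N.euler = 0 ∧ ∃ f, N.s2 f = f

/-- The number of boundary vertices of a map with boundary. -/
noncomputable def nBdryV (N : PreMap) : ℕ :=
  Nat.card {v : N.VertexOf // ∃ f : N.flag, N.s2 f = f ∧ N.vertexOfFlag f = v}

/-- One step of the straight-ahead walk in a `{3^6}` map: rotate three
corners around the vertex (to the opposite edge), then cross it.  Paths of
type `A` are the orbits of this permutation. -/
def stepA (M : PreMap) : Equiv.Perm M.flag := (M.s1 * M.s2) ^ 3 * M.s0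

/-- One step of the straight-ahead walk in a `{4^4}` map.  Paths of type `B`
are the orbits of this permutation. -/
def stepB (M : PreMap) : Equiv.Perm M.flag := (M.s1 * M.s2) ^ 2 * M.s0

/-- `M.IsCycleTypeA k f`: the straight-ahead (type `A`) walk starting at the
flag `f` in a `{3^6}` map closes up after `k` steps (possibly with a twist)
and visits `k` pairwise distinct vertices, i.e. it is a cycle of type `A` of
length `k`. -/
def IsCycleTypeA (M : PreMap) (k : ℕ) (f : M.flag) : Prop :=
  1 ≤ k ∧ ((M.stepA ^ k) f = f ∨ (M.stepA ^ k) f = M.s2 f) ∧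
  ∀ i j : Fin k, M.SameVertex ((M.stepA ^ (i : ℕ)) f) ((M.stepA ^ (j : ℕ)) f) → i = j

/-- A cycle of type `B` in a `{4^4}` map; see `IsCycleTypeA`. -/
def IsCycleTypeB (M : PreMap) (k : ℕ) (f : M.flag) : Prop :=
  1 ≤ k ∧ ((M.stepB ^ k) f = f ∨ (M.stepB ^ k) f = M.s2 f) ∧
  ∀ i j : Fin k, M.SameVertex ((M.stepB ^ (i : ℕ)) f) ((M.stepB ^ (j : ℕ)) f) → i = j

/-- Two vertices of a map joined by an edge. -/
def AdjV (M : PreMap) (v w : M.VertexOf) : Prop :=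
  ∃ f : M.flag, M.vertexOfFlag f = v ∧ M.vertexOfFlag (M.s0 f) = w

end PreMap

/-- The generating relation of the Klein-bottle lattice identifications with
parameters `r`, `s`, `k`: horizontal period `r`, and vertical gluing
`(x, y) ↦ (k - x, y + s)` (a shift by `k` together with a reversal of the
horizontal orientation). -/
def kleinShift (r s k : ℤ) (p q : ℤ × ℤ) : Prop :=
  q = (p.1 + r, p.2) ∨ q = (k - p.1, p.2 + s)

namespace PreMap

/-- `M.IsPlanarKRep r s k`: the map `M` admits a planar polyhedral
`(r, s, k)`-representation `K(r, s, k)`, bounded by two identical cycles with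
opposite orientations: there is a system of `s` distinguished horizontal rows
of `r` vertices each, indexed by the plane lattice modulo the Klein-bottle
identifications `kleinShift r s k`, each row being a cycle and consecutive
rows being joined by an edge. -/
def IsPlanarKRep (M : PreMap) (r s k : ℕ) : Prop :=
  ∃ ℓ : ℤ × ℤ → M.VertexOf,
    (∀ p q : ℤ × ℤ, Relation.EqvGen (kleinShift (r : ℤ) (s : ℤ) (k : ℤ)) p q ↔ ℓ p = ℓ q) ∧
    (∀ x y : ℤ, M.AdjV (ℓ (x, y)) (ℓ (x + 1, y))) ∧
    (∀ y : ℤ, ∃ x x' : ℤ, M.AdjV (ℓ (x, y)) (ℓ (x', y + 1)))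

/-- `M.IsMobiusKRep r s`: the map `M` admits a representation `K(r, s)`
bounded by two Möbius strips: it decomposes into a cylinder containing `s`
distinguished cycles of length `r` and two Möbius strips whose boundary
cycles (of length `r`) are the two boundary cycles of the cylinder. -/
def IsMobiusKRep (M : PreMap) (r s : ℕ) : Prop :=
  ∃ S S' S'' : Set M.flag,
    (∀ g, g ∈ S ∨ g ∈ S' ∨ g ∈ S'') ∧
    Disjoint S S' ∧ Disjoint S S'' ∧ Disjoint S' S'' ∧
    (M.subMap S).IsCylinder ∧ (M.subMap S').IsMobius ∧ (M.subMap S'').IsMobius ∧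
    (M.subMap S').nBdryV = r ∧ (M.subMap S'').nBdryV = r ∧
    (M.subMap S).nV = r * s

/-- `M.HasRSK36 r s k`: a `(r, s, k)`-representation `K(r, s, k)` of a map of
type `{3^6}`: the vertices are exactly the plane lattice modulo the
Klein-bottle identifications `kleinShift r s k`, the horizontal rows are
cycles of type `A` of length `r` and the lattice adjacencies are edges. -/
def HasRSK36 (M : PreMap) (r s k : ℕ) : Prop :=
  ∃ ℓ : ℤ × ℤ → M.VertexOf,
    Function.Surjective ℓ ∧
    (∀ p q : ℤ × ℤ, Relation.EqvGen (kleinShift (r : ℤ) (s : ℤ) (k : ℤ)) p q ↔ ℓ p = ℓ q) ∧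
    (∀ x y : ℤ, M.AdjV (ℓ (x, y)) (ℓ (x + 1, y)) ∧ M.AdjV (ℓ (x, y)) (ℓ (x, y + 1))) ∧
    (∀ y : ℤ, ∃ f : M.flag, M.IsCycleTypeA r f ∧
      ∀ i : Fin r, ∃ x : ℤ, M.vertexOfFlag ((M.stepA ^ (i : ℕ)) f) = ℓ (x, y))

/-- `M.HasRSK44 r s k`: a `(r, s, k)`-representation of a map of type
`{4^4}`; as `HasRSK36`, with rows the cycles of type `B`. -/
def HasRSK44 (M : PreMap) (r s k : ℕ) : Prop :=
  ∃ ℓ : ℤ × ℤ → M.VertexOf,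
    Function.Surjective ℓ ∧
    (∀ p q : ℤ × ℤ, Relation.EqvGen (kleinShift (r : ℤ) (s : ℤ) (k : ℤ)) p q ↔ ℓ p = ℓ q) ∧
    (∀ x y : ℤ, M.AdjV (ℓ (x, y)) (ℓ (x + 1, y)) ∧ M.AdjV (ℓ (x, y)) (ℓ (x, y + 1))) ∧
    (∀ y : ℤ, ∃ f : M.flag, M.IsCycleTypeB r f ∧
      ∀ i : Fin r, ∃ x : ℤ, M.vertexOfFlag ((M.stepB ^ (i : ℕ)) f) = ℓ (x, y))

/-- `M.HasKLT36 l t`: a representation `K(S'(M), 𝓜', 𝓜'') = K(l, t)` of a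
map of type `{3^6}`: a decomposition into a cylinder and two Möbius strips
whose boundary cycles are cycles of type `A` of length `l`, the cylinder
containing `t` such cycles (so that `n = l * t`). -/
def HasKLT36 (M : PreMap) (l t : ℕ) : Prop :=
  ∃ (S S' S'' : Set M.flag) (f f' : M.flag),
    (∀ g, g ∈ S ∨ g ∈ S' ∨ g ∈ S'') ∧
    Disjoint S S' ∧ Disjoint S S'' ∧ Disjoint S' S'' ∧
    (M.subMap S).IsCylinder ∧ (M.subMap S').IsMobius ∧ (M.subMap S'').IsMobius ∧
    M.IsCycleTypeA l f ∧ M.IsCycleTypeA l f' ∧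
    (∀ g ∈ S', M.s2 g ∉ S' → ∃ i < l, M.SameVertex g ((M.stepA ^ i) f)) ∧
    (∀ g ∈ S'', M.s2 g ∉ S'' → ∃ i < l, M.SameVertex g ((M.stepA ^ i) f')) ∧
    M.nV = l * t

end PreMap

/-- The eleven semi-equivelar vertex types on the torus and Klein bottle. -/
def elevenTypes : List (List ℕ) :=
  [[3, 3, 3, 3, 3, 3], [4, 4, 4, 4], [6, 6, 6], [3, 3, 3, 4, 4], [3, 3, 4, 3, 4],
   [3, 6, 3, 6], [3, 3, 3, 3, 6], [4, 8, 8], [3, 12, 12], [4, 6, 12], [3, 4, 6, 4]]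


namespace KleinAux

theorem dih_ne {α : Type} (a b : Equiv.Perm α)
    (ha : ∀ f, a (a f) = f) (hb : ∀ f, b (b f) = f)
    (fa : ∀ f, a f ≠ f) (fb : ∀ f, b f ≠ f) (m : ℕ) :
    ∀ f, ((a * b) ^ m) f ≠ b f := by
  induction m using Nat.strong_induction_on with
  | _ m ih =>
    intro f h
    match m, ih, h with
    | 0, _, h => exact fb f (by simpa using h.symm)
    | 1, _, h => exact fa (b f) (by simpa using h)
    | k + 2, ih, h =>
      apply ih k (by omega) (a (b f))
      have h1 : a (b (((a * b) ^ k) (a (b f)))) = b f := by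
        have : (a * b) ^ (k + 2) = (a * b) * ((a * b) ^ k * (a * b)) := by
          rw [← pow_succ, ← pow_succ']
        rw [this] at h
        simpa using h
      have h2 := congrArg (fun x => b (a x)) h1
      simp only [ha, hb] at h2
      exact h2

theorem dih_class {α : Type} (a b : Equiv.Perm α)
    (ha : ∀ f, a (a f) = f) (hb : ∀ f, b (b f) = f) (rel : α → α → Prop)
    (hrel : ∀ f g, rel f g ↔ (g = a f ∨ g = b f)) (f g : α) :
    (Quot.mk rel f = Quot.mk rel g) ↔
      ∃ i : ℤ, g = ((a * b) ^ i) f ∨ g = b (((a * b) ^ i) f) := by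
  have hinv : ∀ x, a x = b ((a * b)⁻¹ x) := by
    intro x
    have : (a * b)⁻¹ x = b (a x) := by
      rw [Equiv.Perm.inv_eq_iff_eq]; simp [ha, hb]
    rw [this, hb]
  have hA : ∀ x, (∃ i : ℤ, x = ((a * b) ^ i) f ∨ x = b (((a * b) ^ i) f)) →
      (∃ i : ℤ, a x = ((a * b) ^ i) f ∨ a x = b (((a * b) ^ i) f)) := by
    rintro x ⟨i, rfl | rfl⟩
    · refine ⟨-1 + i, Or.inr ?_⟩
      rw [hinv, zpow_add]; simp
    · refine ⟨1 + i, Or.inl ?_⟩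
      rw [zpow_add]; simp
  have hB : ∀ x, (∃ i : ℤ, x = ((a * b) ^ i) f ∨ x = b (((a * b) ^ i) f)) →
      (∃ i : ℤ, b x = ((a * b) ^ i) f ∨ b x = b (((a * b) ^ i) f)) := by
    rintro x ⟨i, rfl | rfl⟩
    · exact ⟨i, Or.inr rfl⟩
    · exact ⟨i, Or.inl (hb _)⟩
  have ma : ∀ x, Quot.mk rel (a x) = Quot.mk rel x := fun x =>
    (Quot.sound ((hrel _ _).2 (Or.inl rfl))).symm
  have mb : ∀ x, Quot.mk rel (b x) = Quot.mk rel x := fun x =>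
    (Quot.sound ((hrel _ _).2 (Or.inr rfl))).symm
  constructor
  · intro h
    have h' := Quot.eqvGen_exact h
    have key : ∀ x y, Relation.EqvGen rel x y →
        ((∃ i : ℤ, x = ((a * b) ^ i) f ∨ x = b (((a * b) ^ i) f)) ↔
         (∃ i : ℤ, y = ((a * b) ^ i) f ∨ y = b (((a * b) ^ i) f))) := by
      intro x y hxy
      induction hxy with
      | rel x y h =>
        rcases (hrel _ _).1 h with rfl | rfl
        · exact ⟨hA x, fun h => by simpa only [ha] using hA _ h⟩
        · exact ⟨hB x, fun h => by simpa only [hb] using hB _ h⟩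
      | refl x => exact Iff.rfl
      | symm x y _ ih => exact ih.symm
      | trans x y z _ _ ih1 ih2 => exact ih1.trans ih2
    exact (key f g h').1 ⟨0, Or.inl (by simp)⟩
  · have hn : ∀ n : ℕ, ∀ x, Quot.mk rel (((a * b) ^ n) x) = Quot.mk rel x := by
      intro n
      induction n with
      | zero => intro x; simp
      | succ n ih => intro x; rw [pow_succ, Equiv.Perm.mul_apply, ih, Equiv.Perm.mul_apply, ma, mb]
    have hz : ∀ i : ℤ, Quot.mk rel (((a * b) ^ i) f) = Quot.mk rel f := by
      intro i
      obtain ⟨n, rfl | rfl⟩ := i.eq_nat_or_neg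
      · rw [zpow_natCast]; exact hn n f
      · have := hn n (((a * b) ^ (-(n : ℤ))) f)
        rw [← this]; simp
    rintro ⟨i, rfl | rfl⟩
    · exact (hz i).symm
    · rw [mb]; exact (hz i).symm

theorem dih {α : Type} [Fintype α] (a b : Equiv.Perm α)
    (ha : ∀ f, a (a f) = f) (hb : ∀ f, b (b f) = f)
    (fa : ∀ f, a f ≠ f) (fb : ∀ f, b f ≠ f) (rel : α → α → Prop)
    (hrel : ∀ f g, rel f g ↔ (g = a f ∨ g = b f)) (f : α) (k : ℕ)
    (hk : Nat.card {g : α // Quot.mk rel f = Quot.mk rel g} / 2 = k) :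
    ((a * b) ^ k) f = f := by
  classical
  let O : Set α := MulAction.orbit (Subgroup.zpowers (a * b)) f
  have hO : ∀ x, x ∈ O ↔ ∃ i : ℤ, x = ((a * b) ^ i) f := by
    intro x
    constructor
    · rintro ⟨⟨_, i, rfl⟩, rfl⟩
      exact ⟨i, rfl⟩
    · rintro ⟨i, rfl⟩
      exact ⟨⟨_, i, rfl⟩, rfl⟩
  have hS : {g : α | Quot.mk rel f = Quot.mk rel g} = O ∪ b '' O := by
    ext x
    rw [Set.mem_ofPred_eq, dih_class a b ha hb rel hrel]
    simp only [Set.mem_union, Set.mem_image, hO]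
    constructor
    · rintro ⟨i, h | h⟩
      · exact Or.inl ⟨i, h⟩
      · exact Or.inr ⟨_, ⟨i, rfl⟩, h.symm⟩
    · rintro (⟨i, h⟩ | ⟨_, ⟨i, rfl⟩, h⟩)
      · exact ⟨i, Or.inl h⟩
      · exact ⟨i, Or.inr h.symm⟩
  have hd : Disjoint O (b '' O) := by
    rw [Set.disjoint_left]
    rintro x hx ⟨y, hy, hxy⟩
    obtain ⟨i, rfl⟩ := (hO _).1 hx
    obtain ⟨j, rfl⟩ := (hO _).1 hy
    have hfo : IsOfFinOrder (a * b) := isOfFinOrder_of_finite _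
    obtain ⟨m, hm⟩ := (hfo.mem_powers_iff_mem_zpowers (y := (a * b) ^ (i - j))).2 ⟨i - j, rfl⟩
    apply dih_ne a b ha hb fa fb m (((a * b) ^ j) f)
    simp only at hm
    rw [hm, ← Equiv.Perm.mul_apply, ← zpow_add, sub_add_cancel, hxy]
  have hcard : Nat.card {g : α // Quot.mk rel f = Quot.mk rel g} = 2 * Nat.card O := by
    have : Nat.card {g : α // Quot.mk rel f = Quot.mk rel g}
      = ({g : α | Quot.mk rel f = Quot.mk rel g}).ncard := rfl
    rw [this, hS, Set.ncard_union_eq hd (Set.toFinite _) (Set.toFinite _),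
      Set.ncard_image_of_injective _ b.injective, ← Nat.card_coe_set_eq]
    omega
  have hp : Function.minimalPeriod ((a * b) • ·) f = k := by
    rw [MulAction.minimalPeriod_eq_card, ← Nat.card_eq_fintype_card]
    change Nat.card O = k
    omega
  have := Function.iterate_minimalPeriod (f := ((a * b) • ·)) (x := f)
  rw [hp, smul_iterate] at this
  exact this

section Abstract

variable {α : Type}

theorem abstract_orientable [Finite α] (p q r : α → α) (hex : α → Prop)
    (pp : ∀ f, p (p f) = f) (qq : ∀ f, q (q f) = f) (rr : ∀ f, r (r f) = f)
    (rp : ∀ f, r (p f) = p (r f))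
    (hp : ∀ f, hex (p f) ↔ hex f) (hq : ∀ f, hex (q f) ↔ hex f)
    (v5 : ∀ f, q (r (q (r (q (r (q (r (q (r f))))))))) = f)
    (h1 : ∀ f, hex f → ¬ hex (r f))
    (h2 : ∀ f, hex f → ¬ hex (r (q (r f))))
    (vex : ∀ f, hex f ∨ hex (q (r f)) ∨ hex (q (r (q (r f)))) ∨
      hex (q (r (q (r (q (r f)))))) ∨ hex (q (r (q (r (q (r (q (r f)))))))))
    (t : ∀ f, ¬ hex f → p (q (p f)) = q (p (q f))) :
    ∃ c : α → Prop, (∀ f, c (p f) ↔ ¬ c f) ∧ (∀ f, c (q f) ↔ ¬ c f) ∧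
      (∀ f, c (r f) ↔ ¬ c f) := by
  classical
  have v5' : ∀ f, r (q (r (q (r f)))) = q (r (q (r (q f)))) := by
    intro f
    have := congrArg (fun x => q (r (q (r (q x))))) (v5 f)
    simpa only [qq, rr] using this
  have h3 : ∀ f, hex f → ¬ hex (r (q (r (q (r f))))) := by
    intro f hf h
    rw [v5', hq] at h
    exact h2 (q f) ((hq f).2 hf) h
  have h4 : ∀ f, hex f → ¬ hex (r (q (r (q (r (q (r f))))))) := by
    intro f hf h
    have e : r (q (r (q (r (q (r f)))))) = q (r (q f)) := by
      rw [v5', qq, rr]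
    rw [e, hq] at h
    exact h1 (q f) ((hq f).2 hf) h
  obtain ⟨P, hP⟩ : ∃ P : α → Prop, ∀ f, P f ↔ hex (r (q (p (r (q (r f)))))) :=
    ⟨_, fun _ => Iff.rfl⟩
  -- triangle facts
  have tr : ∀ h, hex h → p (q (p (r h))) = q (p (q (r h))) := fun h hh => t _ (h1 h hh)
  have tr2 : ∀ h, hex h → p (q (p (r (q (r h))))) = q (p (q (r (q (r h))))) :=
    fun h hh => t _ (h2 h hh)
  have A : ∀ h, hex h → P h → ¬ P (q h) := by
    intro h hh hk hk2
    rw [hP] at hk hk2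
    have e : p (r (q (p (r (q (r (q h))))))) = r (q (r (q (r (p (r (q (p (r (q (r h)))))))))))  := by
      have e1 : q (r (p (r (q (p (r (q (r h)))))))) = p (q (r (q (r h)))) := by
        rw [rp, rr]
        rw [tr2 h hh, qq]
      rw [e1, rp]
      have e2 : r (q (r (q h))) = q (r (q (r (q (r h))))) := by
        rw [v5', qq]
      rw [e2, ← rp, ← rp]
      rw [t]
      · rw [qq, rp]
      · rw [hq]; exact h3 h hh
    have := h3 _ ((hp _).2 hk)
    rw [← e, hp] at this
    exact this hk2
  have B : ∀ h, hex h → P h → ¬ P (p h) := by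
    intro h hh hk hk2
    rw [hP] at hk hk2
    have e : r (q (p (r (q (r (p h)))))) = r (q (r (q (r (q (r (r (q (p (r (q (r h)))))))))))) := by
      rw [rr, qq, ← rp (q (r h)), rr, rp, ← rp (q (p (r h))), tr h hh]
    rw [e] at hk2
    exact h4 _ hk hk2
  have B' : ∀ h, hex h → ¬ P h → P (p h) := by
    intro h hh hk
    rw [hP] at hk ⊢
    rcases vex (p (r (q (r h)))) with x | x | x | x | x
    · rw [hp] at x; exact absurd x (h2 h hh)
    · rw [hq, rp, rr, hp, hq] at x; exact absurd x (h1 h hh)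
    · rw [hq, rp, rr, ← tr h hh, rp, hp, ← rp] at x
      exact absurd x (h2 (p h) ((hp h).2 hh))
    · rw [hq, rp (r (q (r h))), rr, ← tr h hh, rp (q (p (r h))), ← rp h] at x
      exact x
    · rw [hq, v5', hq, qq, rr] at x
      exact absurd x hk
  have C : ∀ h, hex h → (P (q h) ↔ ¬ P h) := by
    intro h hh
    refine ⟨fun x y => A h hh y x, fun hn => ?_⟩
    let S := {f : α // hex f ∧ ¬ P f}
    let g : S → S := fun f => ⟨q (p f.1), (hq _).2 ((hp _).2 f.2.1),
      A _ ((hp _).2 f.2.1) (B' _ f.2.1 f.2.2)⟩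
    have gi : Function.Injective g := by
      intro x y hxy
      have := congrArg (fun z : S => p (q z.1)) hxy
      simp only [g, qq, pp] at this
      exact Subtype.ext this
    obtain ⟨f', hf'⟩ := (Finite.injective_iff_surjective.1 gi) ⟨h, hh, hn⟩
    have e : p f'.1 = q h := by
      have := congrArg (fun z : S => q z.1) hf'
      simpa only [g, qq] using this
    rw [← e]
    exact B' _ f'.2.1 f'.2.2
  have D : ∀ h, hex h → (P (p h) ↔ ¬ P h) := fun h hh =>
    ⟨fun x y => B h hh y x, B' h hh⟩
  obtain ⟨c, hc⟩ : ∃ c : α → Prop, ∀ f, c f ↔ ((hex f ∧ P f) ∨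
      (hex (q (r f)) ∧ P (q (r f))) ∨
      (hex (q (r (q (r f)))) ∧ P (q (r (q (r f))))) ∨
      (hex (q (r (q (r (q (r f)))))) ∧ P (q (r (q (r (q (r f))))))) ∨
      (hex (q (r (q (r (q (r (q (r f)))))))) ∧ P (q (r (q (r (q (r (q (r f)))))))))) :=
    ⟨_, fun _ => Iff.rfl⟩
  have cR : ∀ f, c (q (r f)) ↔ c f := by
    intro f
    rw [hc, hc f, v5]
    tauto
  have cH : ∀ h, hex h → (c h ↔ P h) := by
    intro h hh
    rw [hc]
    simp only [hq, h1 h hh, h2 h hh, h3 h hh, h4 h hh, hh]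
    tauto
  have cqH : ∀ h, hex h → (c (q h) ↔ ¬ c h) := by
    intro h hh
    rw [cH h hh, cH _ ((hq h).2 hh), C h hh]
  have back : ∀ f, (c (q (q (r f))) ↔ ¬ c (q (r f))) → (c (q f) ↔ ¬ c f) := by
    intro f hf
    rw [qq, cR] at hf
    rwa [← cR (r f), rr] at hf
  have cq : ∀ f, c (q f) ↔ ¬ c f := by
    intro f
    rcases vex f with x | x | x | x | x
    · exact cqH _ x
    · exact back _ (cqH _ x)
    · exact back _ (back _ (cqH _ x))
    · exact back _ (back _ (back _ (cqH _ x)))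
    · exact back _ (back _ (back _ (back _ (cqH _ x))))
  have cr : ∀ f, c (r f) ↔ ¬ c f := by
    intro f
    rw [← cR (r f), rr, cq]
  obtain ⟨G, hG⟩ : ∃ G : α → Prop, ∀ x, G x ↔ (c (p x) ↔ ¬ c x) := ⟨_, fun _ => Iff.rfl⟩
  have Gp : ∀ x, G (p x) → G x := by
    intro x hx
    rw [hG, pp] at hx
    rw [hG]; tauto
  have Gr : ∀ x, G x → G (r x) := by
    intro x hx
    rw [hG] at hx ⊢
    rw [← rp, cr, cr, hx]
  have G0 : ∀ h, hex h → G h := by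
    intro h hh
    rw [hG, cH h hh, cH _ ((hp h).2 hh), D h hh]
  have Y : ∀ h, hex h → P h → c (p (r (q (r h)))) := by
    intro h hh hk
    have hk' := (hP h).1 hk
    have : P (r (q (p (r (q (r h)))))) := by
      rw [hP, rr, qq, rp (r (q (r h))), rr, pp, qq, rr]
      exact hh
    rw [← cH _ hk', ← cR, rr, qq] at this
    exact this
  have G1 : ∀ h, hex h → G (q (r h)) := by
    intro h hh
    have hc1 : c (r (q (r h))) ↔ ¬ P h := by rw [cr, cR, cH h hh]
    rw [← rr (q (r h))]
    apply Gr
    rw [hG, hc1]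
    by_cases hk : P h
    · have := Y h hh hk
      tauto
    · have y2 := Y (p h) ((hp h).2 hh) (B' h hh hk)
      have e : r (p (r (q (r (p h))))) = q (r (p (r (q (r h))))) := by
        rw [rp, rr, rp h, tr h hh, rp, rr]
      have := (cr (p (r (q (r (p h))))))
      rw [e, cR] at this
      tauto
  have G2 : ∀ h, hex h → G (q (r (q (r h)))) := by
    intro h hh
    have main : ∀ h, hex h → P h → G (q (r (q (r h)))) := by
      intro h hh hk
      have hk' := (hP h).1 hk
      have := G1 _ ((hp _).2 hk')
      rw [rp, rr, tr2 h hh, qq] at this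
      exact Gp _ this
    by_cases hk : P h
    · exact main h hh hk
    · have := main (q h) ((hq h).2 hh) ((C h hh).2 hk)
      rw [← v5'] at this
      simpa only [rr] using Gr _ this
  refine ⟨c, fun f => (hG f).1 ?_, cq, cr⟩
  rcases vex f with x | x | x | x | x
  · exact G0 _ x
  · have := Gr _ (G0 _ ((hq _).2 x))
    simpa only [qq, rr] using this
  · have := Gr _ (G1 _ ((hq _).2 x))
    simpa only [qq, rr] using this
  · have := G2 _ x
    rwa [v5', qq, qq, rr, qq, rr] at this
  · have := G1 _ x
    rwa [v5] at this

end Abstract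

theorem main (M : PreMap) (hM : M.IsKleinBottleMap) (hT : M.HasVertexType [3, 3, 3, 3, 6]) :
    False := by
  classical
  obtain ⟨⟨-, pp, qq, rr, fp, fq, fr, pr, -, -⟩, -, -, hno⟩ := hM
  have fdp : ∀ f, M.faceDeg (M.s0 f) = M.faceDeg f := by
    intro f
    have : M.faceOfFlag (M.s0 f) = M.faceOfFlag f :=
      (Quot.sound (r := M.fRel) (Or.inl rfl)).symm
    simp only [PreMap.faceDeg, PreMap.SameFace, this]
  have fdq : ∀ f, M.faceDeg (M.s1 f) = M.faceDeg f := by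
    intro f
    have : M.faceOfFlag (M.s1 f) = M.faceOfFlag f :=
      (Quot.sound (r := M.fRel) (Or.inr rfl)).symm
    simp only [PreMap.faceDeg, PreMap.SameFace, this]
  have key : ∀ f, ∃ g, ((M.s1 * M.s2) ^ 5) g = g ∧
      M.faceDeg g = 3 ∧ M.faceDeg (M.s1 (M.s2 g)) = 3 ∧
      M.faceDeg (M.s1 (M.s2 (M.s1 (M.s2 g)))) = 3 ∧
      M.faceDeg (M.s1 (M.s2 (M.s1 (M.s2 (M.s1 (M.s2 g)))))) = 3 ∧
      M.faceDeg (M.s1 (M.s2 (M.s1 (M.s2 (M.s1 (M.s2 (M.s1 (M.s2 g)))))))) = 6 ∧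
      ∃ i : ℕ, i < 5 ∧ (f = ((M.s1 * M.s2) ^ i) g ∨ f = M.s2 (((M.s1 * M.s2) ^ i) g)) := by
    intro f
    obtain ⟨g, hfg, hd, hi⟩ := hT f
    have h5 : ((M.s1 * M.s2) ^ 5) g = g :=
      dih M.s1 M.s2 qq rr fq fr M.vRel (fun _ _ => Iff.rfl) g 5 hd
    obtain ⟨i, hi'⟩ := (dih_class M.s1 M.s2 qq rr M.vRel (fun _ _ => Iff.rfl) g f).1 hfg.symm
    refine ⟨g, h5, hi 0, hi 1, ?_, ?_, ?_, ?_⟩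
    · exact hi 2
    · exact hi 3
    · exact hi 4
    · refine ⟨(i % 5).toNat, by omega, ?_⟩
      have e : ((M.s1 * M.s2) ^ i) g = ((M.s1 * M.s2) ^ (i % 5).toNat) g := by
        have e1 : i = ((i % 5).toNat : ℤ) + 5 * (i / 5) := by omega
        have e2 : ((M.s1 * M.s2) ^ (5 * (i / 5))) g = g := by
          rw [zpow_mul]
          exact Equiv.Perm.zpow_apply_eq_self_of_apply_eq_self (by exact_mod_cast h5) _
        conv_lhs => rw [e1, zpow_add, Equiv.Perm.mul_apply, e2, zpow_natCast]
      rw [← e]; exact hi'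
  obtain ⟨c, c0, c1, c2⟩ := abstract_orientable M.s0 M.s1 M.s2 (fun f => M.faceDeg f = 6)
    pp qq rr (fun f => (pr f).symm) (fun f => by rw [fdp]) (fun f => by rw [fdq])
    (by
      intro f
      obtain ⟨g, h5, k0, k1, k2, k3, k4, i, hi, h⟩ := key f
      simp only [pow_succ, pow_zero, one_mul, Equiv.Perm.mul_apply] at h5
      interval_cases i <;>
      simp only [pow_succ, pow_zero, one_mul, Equiv.Perm.mul_apply, Equiv.Perm.one_apply] at h <;>
      rcases h with rfl | rfl <;> grind)
    (by
      intro f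
      obtain ⟨g, h5, k0, k1, k2, k3, k4, i, hi, h⟩ := key f
      simp only [pow_succ, pow_zero, one_mul, Equiv.Perm.mul_apply] at h5
      interval_cases i <;>
      simp only [pow_succ, pow_zero, one_mul, Equiv.Perm.mul_apply, Equiv.Perm.one_apply] at h <;>
      rcases h with rfl | rfl <;> grind)
    (by
      intro f
      obtain ⟨g, h5, k0, k1, k2, k3, k4, i, hi, h⟩ := key f
      simp only [pow_succ, pow_zero, one_mul, Equiv.Perm.mul_apply] at h5
      interval_cases i <;>
      simp only [pow_succ, pow_zero, one_mul, Equiv.Perm.mul_apply, Equiv.Perm.one_apply] at h <;>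
      rcases h with rfl | rfl <;> grind)
    (by
      intro f
      obtain ⟨g, h5, k0, k1, k2, k3, k4, i, hi, h⟩ := key f
      simp only [pow_succ, pow_zero, one_mul, Equiv.Perm.mul_apply] at h5
      interval_cases i <;>
      simp only [pow_succ, pow_zero, one_mul, Equiv.Perm.mul_apply, Equiv.Perm.one_apply] at h <;>
      rcases h with rfl | rfl <;> grind)
    (by
      intro f hf
      have h3 : M.faceDeg f = 3 := by
        obtain ⟨g, h5, k0, k1, k2, k3, k4, i, hi, h⟩ := key f
        simp only [pow_succ, pow_zero, one_mul, Equiv.Perm.mul_apply] at h5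
        interval_cases i <;>
        simp only [pow_succ, pow_zero, one_mul, Equiv.Perm.mul_apply, Equiv.Perm.one_apply] at h <;>
        rcases h with rfl | rfl <;> grind
      have := dih M.s0 M.s1 pp qq fp fq M.fRel (fun _ _ => Iff.rfl) f 3 h3
      simp only [pow_succ, pow_zero, one_mul, Equiv.Perm.mul_apply] at this
      have h := congrArg (fun x => M.s1 (M.s0 (M.s1 (M.s0 (M.s1 (M.s0 x)))))) this
      simp only [pp, qq] at h
      have h := congrArg (fun x => M.s0 (M.s1 (M.s0 x))) this
      simp only [pp, qq] at h
      have h' := congrArg (fun x => M.s1 (M.s0 (M.s1 x))) h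
      grind)
  apply hno
  refine ⟨fun f => decide (c f), fun f => ?_, fun f => ?_, fun f _ => ?_⟩
  · have := c0 f; by_cases h : c f <;> simp_all
  · have := c1 f; by_cases h : c f <;> simp_all
  · have := c2 f; by_cases h : c f <;> simp_all

end KleinAux

/-- **There is no semi-equivelar map of type `{3^4, 6}` on the Klein bottle**;
equivalently, `i(n)_{3^4,6} = 0` for every `n`. -/
theorem klein_no_3336 :
    (∀ M : PreMap, M.IsKleinBottleMap → ¬ M.HasVertexType [3, 3, 3, 3, 6]) ∧
    (∀ n : ℕ, iKlein [3, 3, 3, 3, 6] n = 0) := by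
  refine ⟨fun M hM hT => KleinAux.main M hM hT, fun n => ?_⟩
  have : IsEmpty (SEKMap [3, 3, 3, 3, 6] n) := ⟨fun M => KleinAux.main M.1 M.2.1 M.2.2.1⟩
  unfold iKlein
  have : IsEmpty (Quot (fun M N : SEKMap [3, 3, 3, 3, 6] n => MapIso M.1 N.1)) :=
    ⟨fun x => Quot.ind (β := fun _ => False) (fun a => this.false a) x⟩
  exact Nat.card_of_isEmpty
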